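/- Let a be a nonzero integer and p a prime with p ∤ 2a and p ≡ 1 (mod 4). Set A_p = 1 + #{(x,y) ∈ 𝔽_p × 𝔽_p : y² = x³ + ax} and t_p = 1 + p − A_p. Then C((p²−1)/2, (p²−1)/4)·a^{(p²−1)/4} − t_p · C((p−1)/2, (p−1)/4)·a^{(p−1)/4} + p ≡ 0 (mod p²). -/

import Mathlib

open Finset

/-- Multiplication by `p`, viewed as an additive map from integers modulo `p` to integers
modulo `p ^ 2`. -/
def mulPrime (p : ℕ) : ZMod p →+ ZMod (p ^ 2) :=
  ZMod.lift p ⟨(AddMonoidHom.mulLeft (p : ZMod (p ^ 2))).comp (Int.castAddHom _), by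
    have h : ((p ^ 2 : ℕ) : ZMod (p ^ 2)) = 0 := ZMod.natCast_self _
    push_cast at h
    simpa [sq] using h⟩

theorem mulPrime_intCast (p : ℕ) (z : ℤ) : mulPrime p (z : ZMod p) = p * z := by
  simp [mulPrime, ZMod.lift_coe]

theorem mulPrime_natCast (p : ℕ) (z : ℕ) : mulPrime p (z : ZMod p) = p * z := by
  simpa using mulPrime_intCast p z

theorem mulPrime_mul_intCast (p : ℕ) (x : ZMod p) (z : ℤ) :
    mulPrime p x * z = mulPrime p (x * z) := by
  obtain ⟨y, rfl⟩ := ZMod.intCast_surjective x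
  rw [← Int.cast_mul, mulPrime_intCast, mulPrime_intCast]
  push_cast
  ring

section Teichmuller

variable {p : ℕ} [hp : Fact p.Prime]

theorem intCast_pow_prime_eq {y z : ℤ} (h : (y : ZMod p) = z) :
    (y : ZMod (p ^ 2)) ^ p = (z : ZMod (p ^ 2)) ^ p := by
  have h1 : (p : ℤ) ∣ y - z := (ZMod.intCast_eq_intCast_iff_dvd_sub z y p).1 h.symm
  have h2 := dvd_sub_pow_of_dvd_sub h1 1
  have h3 : ((p ^ 2 : ℕ) : ℤ) ∣ y ^ p - z ^ p := by simpa using h2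
  have h4 := (ZMod.intCast_eq_intCast_iff_dvd_sub (z ^ p) (y ^ p) (p ^ 2)).2 h3
  exact_mod_cast h4.symm

/-- The Teichmüller representative modulo `p ^ 2` of a residue class modulo `p`. -/
def teichmullerSq (p : ℕ) [hp : Fact p.Prime] : ZMod p →* ZMod (p ^ 2) where
  toFun x := ((x.val : ℤ) : ZMod (p ^ 2)) ^ p
  map_one' := by simp [ZMod.val_one]
  map_mul' x y := by
    rw [← mul_pow, ← Int.cast_mul]
    apply intCast_pow_prime_eq
    simp

theorem teichmullerSq_intCast (z : ℤ) :
    teichmullerSq p (z : ZMod p) = (z : ZMod (p ^ 2)) ^ p := by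
  apply intCast_pow_prime_eq
  simp

theorem teichmullerSq_zero : teichmullerSq p 0 = 0 := by
  simpa [hp.out.ne_zero] using teichmullerSq_intCast (p := p) 0

theorem isUnit_teichmullerSq_sub_one {x : ZMod p} (hx : x ≠ 1) :
    IsUnit (teichmullerSq p x - 1) := by
  obtain ⟨z, rfl⟩ := ZMod.intCast_surjective x
  rw [teichmullerSq_intCast]
  have : (z : ZMod (p ^ 2)) ^ p - 1 = ((z ^ p - 1 : ℤ) : ZMod (p ^ 2)) := by push_cast; rfl
  rw [this, ZMod.coe_int_isUnit_iff_isCoprime]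
  push_cast
  apply IsCoprime.pow_left
  rw [(Nat.prime_iff_prime_int.1 hp.out).coprime_iff_not_dvd, ← ZMod.intCast_zmod_eq_zero_iff_dvd]
  push_cast
  rwa [ZMod.pow_card, sub_eq_zero]

theorem sum_teichmullerSq_pow {k : ℕ} (hk : k ≠ 0) :
    ∑ x : ZMod p, teichmullerSq p x ^ k = if p - 1 ∣ k then (p : ZMod (p ^ 2)) - 1 else 0 := by
  split_ifs with h
  · have h1 : ∀ x : ZMod p, teichmullerSq p x ^ k = 1 - if x = 0 then 1 else 0 := by
      intro x
      split_ifs with hx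
      · simp [hx, teichmullerSq_zero, hk]
      · obtain ⟨m, rfl⟩ := h
        rw [← map_pow, pow_mul, ZMod.pow_card_sub_one_eq_one hx]
        simp
    simp [h1, ZMod.card]
  · obtain ⟨g, hg⟩ := IsCyclic.exists_generator (α := (ZMod p)ˣ)
    have hgk : (g : ZMod p) ^ k ≠ 1 := by
      intro h2
      apply h
      rw [← ZMod.card_units p, ← Nat.card_eq_fintype_card,
        ← orderOf_eq_card_of_forall_mem_zpowers hg]
      apply orderOf_dvd_of_pow_eq_one
      ext
      simpa using h2
    have h3 : ∑ x : ZMod p, teichmullerSq p x ^ k =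
        teichmullerSq p ((g : ZMod p) ^ k) * ∑ x : ZMod p, teichmullerSq p x ^ k := by
      conv_lhs => rw [← Equiv.sum_comp (Equiv.mulLeft₀ (g : ZMod p) g.ne_zero)]
      simp [mul_sum, mul_pow]
    have h4 : (teichmullerSq p ((g : ZMod p) ^ k) - 1) * ∑ x : ZMod p, teichmullerSq p x ^ k = 0 := by
      rw [sub_mul, ← h3]; ring
    exact (isUnit_teichmullerSq_sub_one hgk).mul_right_eq_zero.1 h4

theorem natCard_sq_eq (hp2 : p ≠ 2) (f : ZMod p → ZMod p) :
    (Nat.card {P : ZMod p × ZMod p // P.2 ^ 2 = f P.1} : ℤ) =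
      p + ∑ x, quadraticChar (ZMod p) (f x) := by
  have hc : ringChar (ZMod p) ≠ 2 := by rwa [ZMod.ringChar_zmod_n]
  let e : {P : ZMod p × ZMod p // P.2 ^ 2 = f P.1} ≃ Σ x, {y : ZMod p // y ^ 2 = f x} :=
    { toFun := fun P => ⟨P.1.1, P.1.2, P.2⟩
      invFun := fun Q => ⟨(Q.1, Q.2.1), Q.2.2⟩
      left_inv := fun _ => rfl
      right_inv := fun _ => rfl }
  have h1 : ∀ x, (Nat.card {y : ZMod p // y ^ 2 = f x} : ℤ) = 1 + quadraticChar (ZMod p) (f x) := by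
    intro x
    have := quadraticChar_card_sqrts hc (f x)
    rw [add_comm, ← this, Nat.card_eq_fintype_card, Set.toFinset_card]
    rfl
  rw [Nat.card_congr e, Nat.card_sigma]
  push_cast
  simp only [h1, sum_add_distrib]
  simp

theorem quadraticChar_cast_zmod_sq (hp2 : p ≠ 2) (z : ℤ) :
    ((quadraticChar (ZMod p) z : ℤ) : ZMod (p ^ 2)) = (z : ZMod (p ^ 2)) ^ (p / 2 * p) := by
  have hc : ringChar (ZMod p) ≠ 2 := by rwa [ZMod.ringChar_zmod_n]
  have h := quadraticChar_eq_pow_of_char_ne_two' hc (z : ZMod p)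
  rw [ZMod.card] at h
  have h2 := intCast_pow_prime_eq (p := p) (y := quadraticChar (ZMod p) z) (z := z ^ (p / 2))
    (by rw [h]; push_cast; rfl)
  have h3 : quadraticChar (ZMod p) z ^ p = quadraticChar (ZMod p) z := by
    have hodd := hp.out.odd_of_ne_two hp2
    rcases quadraticChar_isQuadratic (ZMod p) z with h0 | h0 | h0 <;>
      simp [h0, hp.out.ne_zero, hodd.neg_one_pow]
  rw [← h3]
  push_cast
  rw [h2]
  push_cast
  rw [← pow_mul]

theorem sum_quadraticChar_cubic (hp2 : p ≠ 2) (a : ℤ) :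
    ((∑ x : ZMod p, quadraticChar (ZMod p) (x ^ 3 + a * x) : ℤ) : ZMod (p ^ 2)) =
      (p - 1) * ∑ j ∈ range (p / 2 * p + 1),
        if p - 1 ∣ 2 * j + p / 2 * p then
          ((p / 2 * p).choose j : ZMod (p ^ 2)) * (a : ZMod (p ^ 2)) ^ (p / 2 * p - j) else 0 := by
  set N := p / 2 * p with hN
  have hN0 : N ≠ 0 := by
    have := hp.out.two_le
    have : 0 < p / 2 := by omega
    positivity
  have h1 : ∀ x : ZMod p, ((quadraticChar (ZMod p) (x ^ 3 + a * x) : ℤ) : ZMod (p ^ 2)) =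
      ∑ j ∈ range (N + 1), ((N.choose j : ZMod (p ^ 2)) * (a : ZMod (p ^ 2)) ^ (N - j)) *
        teichmullerSq p x ^ (2 * j + N) := by
    intro x
    obtain ⟨z, rfl⟩ := ZMod.intCast_surjective x
    have h2 : ((z : ZMod p) ^ 3 + a * z) = (((z ^ p) ^ 3 + a * z ^ p : ℤ) : ZMod p) := by
      push_cast
      rw [ZMod.pow_card]
    rw [h2, quadraticChar_cast_zmod_sq hp2, ← hN, teichmullerSq_intCast]
    push_cast
    have h3 : ((z : ZMod (p ^ 2)) ^ p) ^ 3 + a * z ^ p = z ^ p * ((z ^ p) ^ 2 + a) := by ring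
    rw [h3, mul_pow, add_pow, mul_sum]
    refine sum_congr rfl fun j _ => ?_
    rw [pow_add _ (2 * j) N, pow_mul _ 2 j]
    ring
  push_cast
  simp_rw [h1]
  rw [sum_comm, mul_sum]
  refine sum_congr rfl fun j _ => ?_
  rw [← mul_sum, sum_teichmullerSq_pow (by omega)]
  split_ifs <;> ring

end Teichmuller

section Binomials

theorem sum_range_bit_split {M : Type*} [AddCommMonoid M] (g : ℕ → M) (m : ℕ) :
    ∑ k ∈ range (2 * m + 1), g k =
      ∑ k ∈ range (m + 1), g (2 * k) + ∑ k ∈ range m, g (2 * k + 1) := by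
  induction m with
  | zero => simp
  | succ m ih =>
    rw [show 2 * (m + 1) + 1 = 2 * m + 1 + 1 + 1 by ring, sum_range_succ, sum_range_succ, ih,
      sum_range_succ _ (m + 1), sum_range_succ (fun k => g (2 * k + 1)) m,
      show 2 * (m + 1) = 2 * m + 1 + 1 by ring]
    abel

theorem sum_range_center {M : Type*} [AddCommMonoid M] (g : ℕ → M) (m : ℕ) :
    ∑ k ∈ range (2 * m + 1), g k = g m + ∑ k ∈ range m, (g k + g (2 * m - k)) := by
  rw [show 2 * m + 1 = m + (m + 1) by ring, sum_range_add, sum_range_succ', sum_add_distrib,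
    ← sum_range_reflect (fun k => g (m + (k + 1)))]
  have : ∀ k ∈ range m, g (m + (m - 1 - k + 1)) = g (2 * m - k) := by
    intro k hk
    rw [mem_range] at hk
    congr 1
    omega
  rw [sum_congr rfl this]
  simp only [add_zero]
  abel

theorem sum_range_ite_four_mul_dvd {M : Type*} [AddCommMonoid M] (f : ℕ → M) {n : ℕ}
    (hn : 0 < n) :
    (∑ j ∈ range (2 * n * (4 * n + 1) + 1),
        if 4 * n ∣ 2 * j + 2 * n * (4 * n + 1) then f j else 0) =
      ∑ k ∈ range (2 * n + 1), f (n * (4 * k + 1)) + ∑ k ∈ range (2 * n), f (n * (4 * k + 3)) := by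
  have h := sum_range_bit_split (fun k => f (n * (2 * k + 1))) (2 * n)
  have h1 : ∀ k, 2 * (2 * k) + 1 = 4 * k + 1 := fun k => by ring
  have h2 : ∀ k, 2 * (2 * k + 1) + 1 = 4 * k + 3 := fun k => by ring
  simp only [h1, h2] at h
  rw [← h, ← sum_filter]
  symm
  apply sum_nbij (fun k => n * (2 * k + 1))
  · intro k hk
    simp only [mem_filter, mem_range] at hk ⊢
    constructor
    · nlinarith
    · exact ⟨k + 2 * n + 1, by ring⟩
  · intro x _ y _ hxy
    have := Nat.eq_of_mul_eq_mul_left hn hxy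
    omega
  · intro j hj
    simp only [coe_filter, mem_range, Set.mem_ofPred_eq] at hj
    obtain ⟨hj, c, hc⟩ := hj
    have hc1 : 2 * n + 1 ≤ c := by
      by_contra! hlt
      have : c ≤ 2 * n := by omega
      nlinarith
    obtain ⟨k, rfl⟩ := Nat.exists_eq_add_of_le hc1
    have hjk : j = n * (2 * k + 1) := by nlinarith
    refine ⟨k, ?_, hjk.symm⟩
    simp only [coe_range, Set.mem_Iio]
    by_contra! hlt
    nlinarith
  · intros
    rfl

theorem sum_alternating_choose_div_mul_prod {K : Type*} [Field K] (N : ℕ) (x : K)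
    (hx : ∀ i ∈ range (N + 1), x - i ≠ 0) :
    (∑ k ∈ range (N + 1), (-1 : K) ^ k * N.choose k / (x - k)) * ∏ k ∈ range (N + 1), (x - k) =
      (-1) ^ N * N.factorial := by
  induction N generalizing x with
  | zero =>
    have := hx 0 (by simp)
    simp at this
    simp [this]
  | succ N ih =>
    have h1 := ih x fun i hi => hx i (by simp at hi ⊢; omega)
    have h2 := ih (x - 1) fun i hi => by
      have := hx (i + 1) (by simp at hi ⊢; omega)
      push_cast at this
      rwa [show x - 1 - (i : K) = x - (i + 1) by ring]
    have h3 : ∑ k ∈ range (N + 1 + 1), (-1 : K) ^ k * (N + 1).choose k / (x - k) =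
        ∑ k ∈ range (N + 1), (-1 : K) ^ k * N.choose k / (x - k) -
          ∑ k ∈ range (N + 1), (-1 : K) ^ k * N.choose k / (x - 1 - k) := by
      have h4 : ∑ k ∈ range (N + 1), (-1 : K) ^ k * N.choose k / (x - k) =
          ∑ k ∈ range (N + 1 + 1), (-1 : K) ^ k * N.choose k / (x - k) := by
        rw [sum_range_succ _ (N + 1)]
        simp
      rw [h4, sum_range_succ', sum_range_succ' _ (N + 1), add_sub_right_comm, ← sum_sub_distrib]
      congr 1
      · refine sum_congr rfl fun k _ => ?_
        rw [Nat.choose_succ_succ]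
        push_cast
        rw [show x - 1 - (k : K) = x - (k + 1) by ring]
        ring
      · simp
    have h5 : ∏ k ∈ range (N + 1 + 1), (x - k) = (∏ k ∈ range (N + 1), (x - k)) * (x - (N + 1)) := by
      rw [prod_range_succ]
      push_cast
      rfl
    have h6 : ∏ k ∈ range (N + 1 + 1), (x - k) = (∏ k ∈ range (N + 1), (x - 1 - k)) * x := by
      rw [prod_range_succ']
      push_cast
      simp only [sub_zero, sub_sub, add_comm]
    rw [h3, sub_mul]
    nth_rewrite 1 [h5]
    rw [h6, ← mul_assoc, ← mul_assoc, h1, h2, Nat.factorial_succ]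
    push_cast
    ring

theorem two_mul_sum_alternating_half {R : Type*} [CommRing R] {n : ℕ} (hn : 0 < n) :
    2 * ∑ k ∈ range n, (-1 : R) ^ k * (2 * n).choose k + (-1) ^ n * (2 * n).choose n = 0 := by
  have h := Int.alternating_sum_range_choose_of_ne (n := 2 * n) (by omega)
  rw [sum_range_center] at h
  have h' := congrArg (Int.cast : ℤ → R) h
  push_cast at h'
  rw [← h', mul_sum, add_comm]
  congr 1
  refine sum_congr rfl fun k hk => ?_
  rw [mem_range] at hk
  have h1 : (-1 : R) ^ (2 * n - k) = (-1) ^ k := by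
    rw [show 2 * n - k = 2 * (n - k) + k by omega, pow_add, pow_mul]
    simp
  rw [Nat.choose_symm (by omega), h1, two_mul]

variable {p : ℕ} [hp : Fact p.Prime]

theorem choose_prime_sub_one {r : ℕ} (hr : r < p) : ((p - 1).choose r : ZMod p) = (-1) ^ r := by
  induction r with
  | zero => simp
  | succ r ih =>
    have h1 := Nat.choose_succ_succ (p - 1) r
    rw [Nat.succ_eq_add_one, Nat.sub_add_cancel hp.out.one_le] at h1
    have h2 : ((p.choose (r + 1) : ℕ) : ZMod p) = 0 :=
      (ZMod.natCast_eq_zero_iff _ _).2 (hp.out.dvd_choose_self (by omega) hr)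
    rw [h1, Nat.cast_add, ih (by omega)] at h2
    rw [pow_succ]
    linear_combination h2

theorem choose_mul_prime_sub_one {m q r : ℕ} (hm : 0 < m) (hr : r < p) :
    ((m * p - 1).choose (q * p + r) : ZMod p) = (m - 1).choose q * (-1) ^ r := by
  have h0 := hp.out.pos
  obtain ⟨m, rfl⟩ : ∃ l, m = l + 1 := ⟨m - 1, by omega⟩
  have h := Choose.choose_modEq_choose_mod_mul_choose_div_nat (n := (m + 1) * p - 1)
    (k := q * p + r) (p := p)
  have e : (m + 1) * p - 1 = (p - 1) + p * m := by
    rw [add_mul, mul_comm m p]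
    omega
  rw [e, mul_comm q p, add_comm (p * q) r, Nat.add_mul_mod_self_left, Nat.add_mul_mod_self_left,
    Nat.add_mul_div_left _ _ h0, Nat.add_mul_div_left _ _ h0, Nat.mod_eq_of_lt hr,
    Nat.mod_eq_of_lt (by omega), Nat.div_eq_of_lt hr, Nat.div_eq_of_lt (by omega : p - 1 < p),
    ← ZMod.natCast_eq_natCast_iff] at h
  rw [e, mul_comm q p, add_comm (p * q) r, h]
  push_cast
  rw [choose_prime_sub_one hr]
  simp [mul_comm]

theorem choose_mul_prime {m q r : ℕ} (hm : 0 < m) (hr0 : 0 < r) (hr : r < p) :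
    ((m * p).choose (q * p + r) : ZMod (p ^ 2)) =
      mulPrime p (m * (m - 1).choose q * (-1) ^ (r - 1) / r) := by
  obtain ⟨s, rfl⟩ : ∃ s, r = s + 1 := ⟨r - 1, by omega⟩
  have h0 := hp.out.pos
  have h1 := Nat.add_one_mul_choose_eq (m * p - 1) (q * p + s)
  have h2 : m * p - 1 + 1 = m * p := Nat.sub_add_cancel (Nat.mul_pos hm h0)
  have hs : ((s + 1 : ℕ) : ZMod p) ≠ 0 := by
    rw [Ne, ZMod.natCast_eq_zero_iff]
    exact Nat.not_dvd_of_pos_of_lt hr0 hr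
  have hdvd : p ∣ (m * p).choose (q * p + s + 1) := by
    rw [h2] at h1
    have h3 : p ∣ (m * p).choose (q * p + s + 1) * (q * p + s + 1) :=
      h1 ▸ (Dvd.intro_left m rfl).mul_right _
    refine (hp.out.dvd_mul.1 h3).resolve_right fun h4 => ?_
    rw [add_assoc, Nat.dvd_add_right (Dvd.intro_left _ rfl)] at h4
    exact Nat.not_dvd_of_pos_of_lt hr0 hr h4
  obtain ⟨c, hc⟩ := hdvd
  rw [h2, hc, mul_assoc p, mul_comm m p, mul_assoc p] at h1
  have h3 := congrArg (Nat.cast : ℕ → ZMod p) (Nat.eq_of_mul_eq_mul_left h0 h1)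
  push_cast at h3
  rw [mul_comm p m, choose_mul_prime_sub_one hm (by omega)] at h3
  rw [← add_assoc, hc, Nat.cast_mul, ← mulPrime_natCast]
  congr 1
  rw [eq_div_iff hs]
  push_cast
  simp only [CharP.cast_eq_zero, mul_zero, zero_add] at h3 ⊢
  linear_combination -h3

theorem factorial_mul_factorial_prime {k l : ℕ} (h : k + l + 1 = p) :
    (k.factorial * l.factorial : ZMod p) = (-1) ^ (k + 1) := by
  induction k generalizing l with
  | zero =>
    have := ZMod.wilsons_lemma p
    rw [show p - 1 = l by omega] at this
    simpa using this
  | succ k ih =>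
    have h1 := ih (l := l + 1) (by omega)
    have h2 : ((k + 1 + l + 1 : ℕ) : ZMod p) = 0 := by rw [h]; exact ZMod.natCast_self p
    rw [Nat.factorial_succ] at h1 ⊢
    push_cast at h1 h2 ⊢
    rw [pow_succ, ← h1]
    linear_combination (k.factorial * l.factorial : ZMod p) * h2

end Binomials

section Main

variable {p n : ℕ} [hp : Fact p.Prime]

theorem choose_offset_eq (hpn : p = 4 * n + 1) (hn : 0 < n) {m : ℕ} (hm0 : 0 < m) (hm : m ≤ n) :
    ((2 * n * p).choose (n * p + m) : ZMod (p ^ 2)) =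
      mulPrime p (-(n * (2 * n).choose n * (-1) ^ m / m)) := by
  rw [choose_mul_prime (by omega) hm0 (by omega)]
  congr 1
  have h : 2 * (2 * n - 1).choose n = (2 * n).choose n := by
    obtain ⟨k, rfl⟩ : ∃ k, n = k + 1 := ⟨n - 1, by omega⟩
    rw [show 2 * (k + 1) = 2 * k + 1 + 1 by ring, Nat.choose_succ_succ (2 * k + 1) k,
      ← Nat.choose_symm_half, Nat.add_sub_cancel, two_mul]
  obtain ⟨m, rfl⟩ : ∃ k, m = k + 1 := ⟨m - 1, by omega⟩
  rw [← h, Nat.add_sub_cancel, pow_succ]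
  push_cast
  ring

theorem natCast_ne_zero_of_lt {m : ℕ} (hm0 : 0 < m) (hm : m < p) : (m : ZMod p) ≠ 0 := by
  rw [Ne, ZMod.natCast_eq_zero_iff]
  exact Nat.not_dvd_of_pos_of_lt hm0 hm

theorem four_mul_natCast (hpn : p = 4 * n + 1) : (4 * n : ZMod p) = -1 := by
  have : ((4 * n + 1 : ℕ) : ZMod p) = 0 := by rw [← hpn]; exact ZMod.natCast_self p
  push_cast at this
  linear_combination this

/-- Half of the sum `∑ (-1) ^ m * (2 * n).choose (n - m) / m` over `m` from `1` to `n`. -/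
def halfSum (p n : ℕ) [Fact p.Prime] : ZMod p :=
  ∑ k ∈ range n, (-1) ^ (n - k) * (2 * n).choose k / (2 * (n - k : ℕ))

theorem two_ne_zero_of_eq (hpn : p = 4 * n + 1) (hn : 0 < n) : (2 : ZMod p) ≠ 0 := by
  exact_mod_cast natCast_ne_zero_of_lt (p := p) (m := 2) (by omega) (by omega)

theorem choose_sq_sub_one_half (hpn : p = 4 * n + 1) (hn : 0 < n) :
    ((2 * n * p + 2 * n).choose (n * p + n) : ZMod (p ^ 2)) =
      (2 * n * p).choose (n * p) * (2 * n).choose n +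
        mulPrime p ((2 * n).choose n * halfSum p n) := by
  have hN : 2 * n * p = n * p + n * p := by ring
  have hnp : n ≤ n * p := Nat.le_mul_of_pos_right n hp.out.pos
  have h1 : (2 * n * p + 2 * n).choose (n * p + n) =
      ∑ j ∈ range (2 * n + 1), (2 * n * p).choose (n * p + n - j) * (2 * n).choose j := by
    rw [add_comm (2 * n * p), Nat.add_choose_eq, Nat.sum_antidiagonal_eq_sum_range_succ_mk]
    symm
    rw [sum_congr rfl fun j _ => mul_comm _ _]
    apply sum_subset
    · intro j hj
      simp only [mem_range] at hj ⊢
      omega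
    · intro j _ hj
      rw [mem_range, not_lt] at hj
      rw [Nat.choose_eq_zero_of_lt (by omega : 2 * n < j), zero_mul]
  rw [h1, sum_range_center, Nat.add_sub_cancel]
  push_cast
  congr 1
  rw [halfSum, mul_sum, map_sum]
  refine sum_congr rfl fun k hk => ?_
  rw [mem_range] at hk
  have h2 : (2 * n * p).choose (n * p + n - (2 * n - k)) =
      (2 * n * p).choose (n * p + (n - k)) := by
    rw [← Nat.choose_symm (by omega)]
    congr 1
    omega
  rw [h2, Nat.choose_symm (by omega : k ≤ 2 * n), show n * p + n - k = n * p + (n - k) by omega,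
    choose_offset_eq hpn hn (by omega) (by omega), ← add_mul, ← map_add,
    ← Int.cast_natCast ((2 * n).choose k), mulPrime_mul_intCast]
  congr 1
  have h3 := natCast_ne_zero_of_lt (p := p) (m := n - k) (by omega) (by omega)
  have h4 := two_ne_zero_of_eq hpn hn
  have h5 := four_mul_natCast hpn
  rw [Int.cast_natCast]
  field_simp
  linear_combination (-((2 * n).choose n * (2 * n).choose k) : ZMod p) * h5

theorem sum_choose_one (hpn : p = 4 * n + 1) (hn : 0 < n) :
    ∑ k ∈ range n, (((2 * n * p).choose (n * (4 * k + 1)) : ZMod (p ^ 2)) +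
        (2 * n * p).choose (n * (4 * (2 * n - k) + 1))) =
      mulPrime p ((2 * n).choose n + halfSum p n) := by
  have h1 : ∀ k ∈ range n, (((2 * n * p).choose (n * (4 * k + 1)) : ZMod (p ^ 2)) +
        (2 * n * p).choose (n * (4 * (2 * n - k) + 1))) =
      mulPrime p (-(-1) ^ n * (2 * ((-1) ^ k * (2 * n).choose k)) +
        (-1) ^ (n - k) * (2 * n).choose k / (2 * (n - k : ℕ))) := by
    intro k hk
    rw [mem_range] at hk
    have h2 : (2 * n * p).choose (n * (4 * (2 * n - k) + 1)) =
        (2 * n * p).choose (n * (4 * k + 1)) := by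
      obtain ⟨l, rfl⟩ : ∃ l, n = k + l := Nat.exists_eq_add_of_le hk.le
      have : 2 * (k + l) - k = k + 2 * l := by omega
      rw [this, hpn]
      apply Nat.choose_symm_of_eq_add
      ring
    have h3 : n * (4 * k + 1) = k * p + (n - k) := by
      zify [hk.le]
      rw [hpn]
      push_cast
      ring
    have h4 : (2 * n) * (2 * n - 1).choose k = (2 * n).choose k * (2 * n - k) := by
      have := Nat.add_one_mul_choose_eq (2 * n - 1) k
      have h5 := Nat.choose_succ_right_eq (2 * n) k
      rw [Nat.sub_add_cancel (by omega)] at this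
      rw [this, h5]
    have h5 := congrArg (Nat.cast : ℕ → ZMod p) h4
    have h6 := natCast_ne_zero_of_lt (p := p) (m := n - k) (by omega) (by omega)
    have h7 := two_ne_zero_of_eq hpn hn
    have h8 := four_mul_natCast hpn
    obtain ⟨l, rfl⟩ : ∃ l, n = k + (l + 1) := ⟨n - k - 1, by omega⟩
    have h9 : k + (l + 1) - k = l + 1 := by omega
    have h10 : 2 * (k + (l + 1)) - k = k + 2 * (l + 1) := by omega
    have h11 : (-1 : ZMod p) ^ k * (-1) ^ k = 1 := by rw [← mul_pow]; simp
    rw [h2, h3, choose_mul_prime (by omega) (by omega) (by omega), ← map_add]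
    congr 1
    rw [h9] at h6 ⊢
    rw [h10] at h5
    rw [Nat.add_sub_cancel]
    push_cast at h5 h6 h8 ⊢
    rw [h5, pow_add]
    field_simp
    linear_combination ((2 * (k + (l + 1))).choose k * (-1) ^ l : ZMod p) * h8 -
      (4 * (2 * (k + (l + 1))).choose k * (-1) ^ l * (l + 1) : ZMod p) * h11
  rw [sum_congr rfl h1, ← map_sum, sum_add_distrib, ← halfSum, ← mul_sum, ← mul_sum]
  have h2 := two_mul_sum_alternating_half (R := ZMod p) hn
  have h3 : (-1 : ZMod p) ^ n * (-1) ^ n = 1 := by rw [← mul_pow]; simp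
  congr 2
  linear_combination (-(-1) ^ n) * h2 + ((2 * n).choose n : ZMod p) * h3

/-- The sum of the terms of index `n * (4 * k + 3)`, divided by `p`. -/
def conjSum (p n : ℕ) [Fact p.Prime] : ZMod p :=
  ∑ k ∈ range (2 * n),
    (2 * n : ℕ) * (2 * n - 1).choose k * (-1) ^ (3 * n - k - 1) / (3 * n - k : ℕ)

theorem sum_choose_three (hpn : p = 4 * n + 1) (hn : 0 < n) :
    ∑ k ∈ range (2 * n), ((2 * n * p).choose (n * (4 * k + 3)) : ZMod (p ^ 2)) =
      mulPrime p (conjSum p n) := by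
  rw [conjSum, map_sum]
  refine sum_congr rfl fun k hk => ?_
  rw [mem_range] at hk
  have h3 : n * (4 * k + 3) = k * p + (3 * n - k) := by
    zify [show k ≤ 3 * n by omega]
    rw [hpn]
    push_cast
    ring
  rw [h3, choose_mul_prime (by omega) (by omega) (by omega)]

theorem conjSum_mul_choose (hpn : p = 4 * n + 1) (hn : 0 < n) :
    conjSum p n * (2 * n).choose n = 1 := by
  have h1 := sum_alternating_choose_div_mul_prod (K := ZMod p) (2 * n - 1) ((3 * n : ℕ) : ZMod p)
    (fun i hi => by
      rw [mem_range] at hi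
      rw [← Nat.cast_sub (by omega)]
      exact natCast_ne_zero_of_lt (by omega) (by omega))
  rw [Nat.sub_add_cancel (by omega)] at h1
  have h2 : ∏ k ∈ range (2 * n), (((3 * n : ℕ) : ZMod p) - k) = (3 * n).descFactorial (2 * n) := by
    rw [Nat.descFactorial_eq_prod_range, Nat.cast_prod]
    refine prod_congr rfl fun k hk => ?_
    rw [mem_range] at hk
    rw [Nat.cast_sub (by omega)]
  have h3 : conjSum p n = (2 * n : ℕ) * (-1) ^ (n + 1) *
      ∑ k ∈ range (2 * n), (-1) ^ k * (2 * n - 1).choose k / (((3 * n : ℕ) : ZMod p) - k) := by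
    rw [conjSum, mul_sum]
    refine sum_congr rfl fun k hk => ?_
    rw [mem_range] at hk
    have : (-1 : ZMod p) ^ (3 * n - k - 1) = (-1) ^ (n + 1) * (-1) ^ k := by
      obtain ⟨l, hl⟩ : ∃ l, 2 * n = k + (l + 1) := ⟨2 * n - k - 1, by omega⟩
      rw [show 3 * n - k - 1 = n + l by omega, ← pow_add]
      apply neg_one_pow_congr
      simp only [Nat.even_add, Nat.even_add_one]
      have : Even (k + (l + 1)) := hl ▸ even_two_mul n
      simp only [Nat.even_add, Nat.even_add_one] at this
      tauto
    rw [this, Nat.cast_sub (by omega)]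
    ring
  have h4 : n.factorial * (3 * n).descFactorial (2 * n) = (3 * n).factorial := by
    have := Nat.factorial_mul_descFactorial (show 2 * n ≤ 3 * n by omega)
    rwa [show 3 * n - 2 * n = n by omega] at this
  have h5 := congrArg (Nat.cast : ℕ → ZMod p) h4
  have h6 := factorial_mul_factorial_prime (p := p) (k := n) (l := 3 * n) (by omega)
  have h7 := factorial_mul_factorial_prime (p := p) (k := 2 * n) (l := 2 * n) (by omega)
  have h8 : 2 * n * (2 * n - 1).factorial = (2 * n).factorial :=
    Nat.mul_factorial_pred (by omega)
  have h9 := congrArg (Nat.cast : ℕ → ZMod p) h8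
  have h10 : (2 * n).choose n * n.factorial * n.factorial = (2 * n).factorial := by
    have := Nat.choose_mul_factorial_mul_factorial (show n ≤ 2 * n by omega)
    rwa [show 2 * n - n = n by omega] at this
  have h11 := congrArg (Nat.cast : ℕ → ZMod p) h10
  have h12 : (-1 : ZMod p) ^ (2 * n - 1) = -1 := by
    rw [Odd.neg_one_pow]
    exact ⟨n - 1, by omega⟩
  have h13 : (-1 : ZMod p) ^ (2 * n + 1) = -1 := Odd.neg_one_pow ⟨n, rfl⟩
  have h14 : (-1 : ZMod p) ^ (n + 1) * (-1) ^ (n + 1) = 1 := by rw [← mul_pow]; simp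
  rw [h2, h12] at h1
  rw [h13] at h7
  push_cast at h5 h9 h11 h3 h1
  set S := ∑ k ∈ range (2 * n), (-1) ^ k * ((2 * n - 1).choose k : ZMod p) / (3 * n - k)
  set e := (-1 : ZMod p) ^ (n + 1)
  have h15 : S * (n.factorial * (3 * n).factorial) =
      -((2 * n - 1).factorial * n.factorial * n.factorial) := by
    rw [← h5]
    linear_combination ((n.factorial : ZMod p) * n.factorial) * h1
  rw [h6] at h15
  rw [h3]
  linear_combination (2 * n * (2 * n).choose n : ZMod p) * h15 -
    ((2 * n).choose n * n.factorial * n.factorial : ZMod p) * h9 -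
    ((2 * n).factorial : ZMod p) * h11 - h7

theorem trace_eq (hpn : p = 4 * n + 1) (hn : 0 < n) (a : ℤ) (ha : (a : ZMod p) ≠ 0) :
    ((∑ x : ZMod p, quadraticChar (ZMod p) (x ^ 3 + a * x) : ℤ) : ZMod (p ^ 2)) =
      (p - 1) * ((2 * n * p).choose (n * p) * a ^ (n * p) +
        mulPrime p ((2 * n).choose n + halfSum p n) * a ^ n +
        mulPrime p (conjSum p n) * a ^ (3 * n)) := by
  have h1 := sum_quadraticChar_cubic (p := p) (by omega) a
  rw [show p / 2 = 2 * n by omega, show p - 1 = 4 * n by omega] at h1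
  have h2 := sum_range_ite_four_mul_dvd (fun j => ((2 * n * p).choose j : ZMod (p ^ 2)) *
    (a : ZMod (p ^ 2)) ^ (2 * n * p - j)) hn
  rw [← hpn] at h2
  have hfermat : (a : ZMod p) ^ (4 * n) = 1 := by
    rw [show 4 * n = p - 1 by omega]
    exact ZMod.pow_card_sub_one_eq_one ha
  have hterm : ∀ {j q r : ℕ} (c d : ℕ), j = q * p + r → 0 < r → r < p →
      2 * n * p = j + (4 * n * c + d) →
      ((2 * n * p).choose j : ZMod (p ^ 2)) * a ^ (2 * n * p - j) =
        (2 * n * p).choose j * a ^ d := by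
    intro j q r c d hj hr0 hr he
    rw [Nat.sub_eq_of_eq_add' he, hj, choose_mul_prime (by omega) hr0 hr, ← Int.cast_pow,
      ← Int.cast_pow, mulPrime_mul_intCast, mulPrime_mul_intCast]
    push_cast
    rw [pow_add, pow_mul, hfermat, one_pow, one_mul]
  rw [h1, h2, ← sum_choose_one hpn hn, ← sum_choose_three hpn hn, sum_range_center, sum_mul,
    sum_mul]
  refine congrArg₂ _ rfl (congrArg₂ _ (congrArg₂ _ ?_ ?_) ?_)
  · rw [← hpn]
    congr 2
    exact Nat.sub_eq_of_eq_add (by ring)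
  · refine sum_congr rfl fun k hk => ?_
    rw [mem_range] at hk
    rw [add_mul]
    congr 1
    · apply hterm (q := k) (r := n - k) (2 * n - k) n _ (by omega) (by omega)
      · zify [show k ≤ 2 * n by omega]
        rw [hpn]
        push_cast
        ring
      · zify [hk.le]
        rw [hpn]
        push_cast
        ring
    · apply hterm (q := 2 * n - k - 1) (r := p - (n - k)) k n _ (by omega) (by omega)
      · zify [show k ≤ 2 * n by omega]
        rw [hpn]
        push_cast
        ring
      · zify [hk.le, show k ≤ 2 * n by omega, show 1 ≤ 2 * n - k by omega, show n - k ≤ p by omega]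
        rw [hpn]
        push_cast
        ring
  · refine sum_congr rfl fun k hk => ?_
    rw [mem_range] at hk
    apply hterm (q := k) (r := 3 * n - k) (2 * n - 1 - k) (3 * n) _ (by omega) (by omega)
    · zify [show 1 ≤ 2 * n by omega, show k ≤ 2 * n - 1 by omega]
      rw [hpn]
      push_cast
      ring
    · zify [show k ≤ 3 * n by omega]
      rw [hpn]
      push_cast
      ring

theorem choose_trace_identity (hpn : p = 4 * n + 1) (hn : 0 < n) (a : ℤ) (ha : (a : ZMod p) ≠ 0) :
    ((2 * n * p + 2 * n).choose (n * p + n) : ZMod (p ^ 2)) * a ^ (n * p + n) +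
      (∑ x : ZMod p, quadraticChar (ZMod p) (x ^ 3 + a * x) : ℤ) * (2 * n).choose n * a ^ n + p
        = 0 := by
  obtain ⟨e, he⟩ := ZMod.intCast_surjective (halfSum p n)
  obtain ⟨s, hs⟩ := ZMod.intCast_surjective (conjSum p n)
  have key : ∀ x y : ℤ, (x : ZMod p) = y → (p : ZMod (p ^ 2)) * x = p * y := by
    intro x y h
    rw [← mulPrime_intCast, ← mulPrime_intCast, h]
  have h0 : (p : ZMod (p ^ 2)) * p = 0 := by
    have h : ((p ^ 2 : ℕ) : ZMod (p ^ 2)) = 0 := ZMod.natCast_self _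
    push_cast at h
    exact (sq _).symm.trans h
  have h1 := key (s * (2 * n).choose n) 1 (by
    push_cast
    rw [hs, conjSum_mul_choose hpn hn])
  have h2 := key (a ^ (4 * n)) 1 (by
    push_cast
    rw [show 4 * n = p - 1 by omega]
    exact ZMod.pow_card_sub_one_eq_one ha)
  have h3 := key (a ^ (n * p)) (a ^ n) (by
    push_cast
    rw [pow_mul, ZMod.pow_card])
  have h4 := key ((2 * n * p).choose (n * p)) ((2 * n).choose n) (by
    have h := Choose.choose_modEq_choose_mod_mul_choose_div_nat (n := 2 * n * p)
      (k := n * p) (p := p)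
    rw [Nat.mul_mod_left, Nat.mul_mod_left, Nat.mul_div_left _ hp.out.pos,
      Nat.mul_div_left _ hp.out.pos, ← ZMod.natCast_eq_natCast_iff] at h
    simpa using h)
  have h5 : mulPrime p ((2 * n).choose n * halfSum p n) = p * ((2 * n).choose n * e) := by
    rw [← he]
    exact_mod_cast mulPrime_intCast p ((2 * n).choose n * e)
  have h6 : mulPrime p ((2 * n).choose n + halfSum p n) = p * ((2 * n).choose n + e) := by
    rw [← he]
    exact_mod_cast mulPrime_intCast p ((2 * n).choose n + e)
  rw [trace_eq hpn hn a ha, choose_sq_sub_one_half hpn hn, h5, h6, ← hs, mulPrime_intCast]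
  push_cast at h1 h2 h3 h4
  rw [pow_add, mul_comm 3 n, pow_mul _ n 3]
  rw [mul_comm 4 n, pow_mul _ n 4] at h2
  generalize (a : ZMod (p ^ 2)) ^ (n * p) = Y at *
  generalize (a : ZMod (p ^ 2)) ^ n = A at *
  generalize ((2 * n * p).choose (n * p) : ZMod (p ^ 2)) = X at *
  generalize ((2 * n).choose n : ZMod (p ^ 2)) = c at *
  generalize (e : ZMod (p ^ 2)) = e at *
  generalize (s : ZMod (p ^ 2)) = s at *
  generalize (p : ZMod (p ^ 2)) = q at *
  linear_combination (c * A * ((c + e) * A + s * A ^ 3)) * h0 +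
    (c * e * A + c * c * A) * h3 + (c * A * Y) * h4 - A ^ 4 * h1 - h2

end Main

theorem stmt12 (a : ℤ) (ha : a ≠ 0) (p : ℕ) (hp : p.Prime)
    (hpa : ¬ ((p : ℤ) ∣ 2 * a)) (hp4 : p % 4 = 1)
    (Ap : ℕ)
    (hAp : Ap = 1 + Nat.card {P : ZMod p × ZMod p //
      P.2 ^ 2 = P.1 ^ 3 + (a : ZMod p) * P.1})
    (tp : ℤ) (htp : tp = 1 + (p : ℤ) - (Ap : ℤ)) :
    (((p ^ 2 - 1) / 2).choose ((p ^ 2 - 1) / 4) : ℤ) * a ^ ((p ^ 2 - 1) / 4) -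
        tp * (((p - 1) / 2).choose ((p - 1) / 4) : ℤ) * a ^ ((p - 1) / 4) + (p : ℤ) ≡ 0
      [ZMOD (p ^ 2 : ℕ)] := by
  have : Fact p.Prime := ⟨hp⟩
  obtain ⟨n, hpn⟩ : ∃ n, p = 4 * n + 1 := ⟨p / 4, by omega⟩
  have hn : 0 < n := by
    have := hp.two_le
    omega
  have ha' : (a : ZMod p) ≠ 0 := fun h =>
    hpa (((ZMod.intCast_zmod_eq_zero_iff_dvd a p).1 h).mul_left 2)
  have hsq : p ^ 2 = 4 * (n * p + n) + 1 := by
    rw [hpn]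
    ring
  have ht : tp = -∑ x : ZMod p, quadraticChar (ZMod p) (x ^ 3 + a * x) := by
    have h := natCard_sq_eq (p := p) (by omega) (fun x => x ^ 3 + a * x)
    rw [htp, hAp]
    push_cast
    rw [h]
    ring
  have key := choose_trace_identity hpn hn a ha'
  rw [show (p ^ 2 - 1) / 2 = 2 * n * p + 2 * n by rw [mul_assoc]; omega,
    show (p ^ 2 - 1) / 4 = n * p + n by omega, show (p - 1) / 2 = 2 * n by omega,
    show (p - 1) / 4 = n by omega, ← ZMod.intCast_eq_intCast_iff, ht]
  rw [← sub_eq_zero, ← key]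
  push_cast
  ring
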